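/- Let N ≥ 1, c ≥ 1, and for i = 1, …, N let φᵢ : ℝⁿ → ℝᶜ have twice continuously differentiable components with ‖∇²(φᵢ)ⱼ(x)‖ ≤ L for all x ∈ ℝⁿ and all j ∈ {1, …, c}, and let bᵢ ∈ {1, …, c}. For x ∈ ℝⁿ let pᵢ(x) ∈ ℝᶜ be the softmax vector pᵢ(x)ⱼ = exp((φᵢ(x))ⱼ)/Σ_{k=1}^{c} exp((φᵢ(x))ₖ). Define f(x) = −Σᵢ₌₁ᴺ log pᵢ(x)_{bᵢ} and H(x) = Σᵢ₌₁ᴺ Jᵢ(x)ᵀ·(diag(pᵢ(x)) − pᵢ(x)pᵢ(x)ᵀ)·Jᵢ(x), where Jᵢ(x) ∈ ℝ^{c×n} is the Jacobian of φᵢ at x. Suppose f has a global minimizer x_* and satisfies the Polyak–Łojasiewicz condition with constant μ > 0: f(x) − f(x_*) ≤ (1/(2μ))‖∇f(x)‖² for all x ∈ ℝⁿ. Then for every x ∈ ℝⁿ, ‖∇²f(x) − H(x)‖ ≤ (L/μ)·‖∇f(x)‖² + 2L·f(x_*). -/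

import Mathlib

open RealInnerProductSpace

section LogSumExp

variable {ι E : Type*} [Fintype ι] [Nonempty ι]

/-- The log-sum-exp function of a finite family of real functions. -/
noncomputable def logSumExp (g : ι → E → ℝ) (x : E) : ℝ := Real.log (∑ k, Real.exp (g k x))

theorem sum_exp_pos (g : ι → E → ℝ) (x : E) : 0 < ∑ k, Real.exp (g k x) :=
  Finset.sum_pos (fun _ _ => Real.exp_pos _) Finset.univ_nonempty

theorem exp_div_sum_exp (g : ι → E → ℝ) (x : E) (j : ι) :
    Real.exp (g j x) / ∑ k, Real.exp (g k x) = Real.exp (g j x - logSumExp g x) := by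
  rw [Real.exp_sub, logSumExp, Real.exp_log (sum_exp_pos g x)]

theorem sum_exp_sub_logSumExp (g : ι → E → ℝ) (x : E) :
    ∑ j, Real.exp (g j x - logSumExp g x) = 1 := by
  simp_rw [← exp_div_sum_exp]
  rw [← Finset.sum_div, div_self (sum_exp_pos g x).ne']

/-- The `ℓ¹`-distance of a softmax vector to a vertex of the simplex is at most twice the
cross-entropy loss. -/
theorem sum_abs_softmax_sub_le [DecidableEq ι] (g : ι → E → ℝ) (x : E) (b : ι) :
    ∑ j, |Real.exp (g j x - logSumExp g x) - if j = b then 1 else 0|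
      ≤ 2 * (logSumExp g x - g b x) := by
  have hsum := sum_exp_sub_logSumExp g x
  have hle : Real.exp (g b x - logSumExp g x) ≤ 1 :=
    hsum ▸ Finset.single_le_sum (f := fun j => Real.exp (g j x - logSumExp g x))
      (fun _ _ => (Real.exp_pos _).le) (Finset.mem_univ b)
  have hlog := Real.add_one_le_exp (g b x - logSumExp g x)
  rw [← Finset.add_sum_erase _ _ (Finset.mem_univ b)] at hsum ⊢
  have hrest : ∀ j ∈ Finset.univ.erase b,
      |Real.exp (g j x - logSumExp g x) - if j = b then 1 else 0|
        = Real.exp (g j x - logSumExp g x) := fun j hj => by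
    rw [if_neg (Finset.ne_of_mem_erase hj), sub_zero, abs_of_pos (Real.exp_pos _)]
  rw [Finset.sum_congr rfl hrest, if_pos rfl, abs_of_nonpos (by linarith)]
  linarith

variable [NormedAddCommGroup E]

theorem hasFDerivAt_logSumExp [NormedSpace ℝ E] {g : ι → E → ℝ} {g' : ι → E →L[ℝ] ℝ} {x : E}
    (hg : ∀ j, HasFDerivAt (g j) (g' j) x) :
    HasFDerivAt (logSumExp g) (∑ j, Real.exp (g j x - logSumExp g x) • g' j) x := by
  have h := (HasFDerivAt.fun_sum (u := Finset.univ) fun j _ => (hg j).exp).log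
    (sum_exp_pos g x).ne'
  refine h.congr_fderiv ?_
  rw [Finset.smul_sum]
  refine Finset.sum_congr rfl fun j _ => ?_
  rw [smul_smul, ← exp_div_sum_exp, div_eq_inv_mul]

variable [InnerProductSpace ℝ E] [CompleteSpace E]

theorem hasGradientAt_logSumExp_sub [DecidableEq ι] {g : ι → E → ℝ} {x : E}
    (hg : ∀ j, DifferentiableAt ℝ (g j) x) (b : ι) :
    HasGradientAt (fun y => logSumExp g y - g b y)
      (∑ j, (Real.exp (g j x - logSumExp g x) - if j = b then 1 else 0) • gradient (g j) x) x := by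
  have hg' := fun j => (hg j).hasGradientAt.hasFDerivAt
  rw [hasGradientAt_iff_hasFDerivAt]
  refine ((hasFDerivAt_logSumExp hg').sub (hg' b)).congr_fderiv ?_
  simp [map_sum, sub_smul, Finset.sum_sub_distrib]

/-- The derivative of the gradient of the cross-entropy loss: a Hessian term for each component
plus the Gauss-Newton term. -/
theorem hasFDerivAt_gradient_logSumExp_sub [DecidableEq ι] {g : ι → E → ℝ}
    {x : E} (hg : ∀ j, DifferentiableAt ℝ (g j) x)
    (hg2 : ∀ j, DifferentiableAt ℝ (gradient (g j)) x) (b : ι) :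
    HasFDerivAt
      (fun y => ∑ j, (Real.exp (g j y - logSumExp g y) - if j = b then 1 else 0) •
        gradient (g j) y)
      (∑ j, ((Real.exp (g j x - logSumExp g x) - if j = b then 1 else 0) •
          fderiv ℝ (gradient (g j)) x +
        (Real.exp (g j x - logSumExp g x) • (innerSL ℝ (gradient (g j) x) -
          ∑ k, Real.exp (g k x - logSumExp g x) • innerSL ℝ (gradient (g k) x))).smulRight
            (gradient (g j) x))) x := by
  have hg' : ∀ j, HasFDerivAt (g j) (innerSL ℝ (gradient (g j) x)) x :=
    fun j => (hg j).hasGradientAt.hasFDerivAt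
  exact HasFDerivAt.fun_sum fun j _ =>
    ((((hg' j).sub (hasFDerivAt_logSumExp hg')).exp).sub_const _).smul (hg2 j).hasFDerivAt

end LogSumExp

theorem ContDiff.differentiable_gradient {E : Type*} [NormedAddCommGroup E]
    [InnerProductSpace ℝ E] [CompleteSpace E] {g : E → ℝ} (hg : ContDiff ℝ 2 g) :
    Differentiable ℝ (gradient g) :=
  (InnerProductSpace.toDual ℝ E).symm.toContinuousLinearEquiv.differentiable.comp
    ((hg.fderiv_right (m := 1) (by norm_num)).differentiable one_ne_zero)

/-- Generalized Gauss–Newton approximation error for the softmax cross-entropy objective: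
under the
Polyak–Łojasiewicz condition: `‖∇²f(x) − H(x)‖ ≤ (L/μ)‖∇f(x)‖² + 2L f(x_*)`. Here `φ i j` is the `j`-th component of the `c`-valued model
`φᵢ : ℝⁿ → ℝᶜ`, `p i x j` is the softmax probability, and `H x` is the action of
`Σᵢ Jᵢ(x)ᵀ(diag(pᵢ(x)) − pᵢ(x)pᵢ(x)ᵀ)Jᵢ(x)`. -/
theorem stmt19 {n : ℕ} (N c : ℕ) (hN : 1 ≤ N) (hc : 1 ≤ c) (L μ : ℝ) (hμ : 0 < μ)
    (φ : Fin N → Fin c → EuclideanSpace ℝ (Fin n) → ℝ) (b : Fin N → Fin c)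
    (hφ : ∀ i j, ContDiff ℝ 2 (φ i j))
    (hHessφ : ∀ i j x, ‖fderiv ℝ (gradient (φ i j)) x‖ ≤ L)
    (p : Fin N → EuclideanSpace ℝ (Fin n) → Fin c → ℝ)
    (hp : ∀ i x j, p i x j = Real.exp (φ i j x) / ∑ k, Real.exp (φ i k x))
    (f : EuclideanSpace ℝ (Fin n) → ℝ)
    (hfdef : ∀ x, f x = -∑ i, Real.log (p i x (b i)))
    (H : EuclideanSpace ℝ (Fin n) →
      EuclideanSpace ℝ (Fin n) →L[ℝ] EuclideanSpace ℝ (Fin n))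
    (hHdef : ∀ x v, H x v = ∑ i, ∑ j,
      (p i x j * ⟪gradient (φ i j) x, v⟫
        - p i x j * ∑ k, p i x k * ⟪gradient (φ i k) x, v⟫) • gradient (φ i j) x)
    (xstar : EuclideanSpace ℝ (Fin n)) (hmin : ∀ y, f xstar ≤ f y)
    (hPL : ∀ x, f x - f xstar ≤ 1 / (2 * μ) * ‖gradient f x‖ ^ 2) :
    ∀ x, ‖fderiv ℝ (gradient f) x - H x‖
      ≤ L / μ * ‖gradient f x‖ ^ 2 + 2 * L * f xstar := by
  intro x
  have : Nonempty (Fin c) := ⟨⟨0, hc⟩⟩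
  have hφ1 : ∀ i j, Differentiable ℝ (φ i j) := fun i j => (hφ i j).differentiable two_ne_zero
  have hp' : ∀ i x j, p i x j = Real.exp (φ i j x - logSumExp (φ i) x) :=
    fun i x j => (hp i x j).trans (exp_div_sum_exp (φ i) x j)
  have hf : ∀ x, f x = ∑ i, (logSumExp (φ i) x - φ i (b i) x) := fun x => by
    simp [hfdef, hp']
  have hgrad : gradient f = fun y => ∑ i, ∑ j,
      (Real.exp (φ i j y - logSumExp (φ i) y) - if j = b i then 1 else 0) •
        gradient (φ i j) y := by
    funext y
    refine HasGradientAt.gradient ?_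
    rw [hasGradientAt_iff_hasFDerivAt, map_sum, funext hf]
    exact HasFDerivAt.fun_sum fun i _ =>
      (hasGradientAt_logSumExp_sub (fun j => hφ1 i j y) (b i)).hasFDerivAt
  have hdiff : fderiv ℝ (gradient f) x - H x = ∑ i, ∑ j,
      (Real.exp (φ i j x - logSumExp (φ i) x) - if j = b i then 1 else 0) •
        fderiv ℝ (gradient (φ i j)) x := by
    rw [hgrad, (HasFDerivAt.fun_sum fun i _ => hasFDerivAt_gradient_logSumExp_sub
      (fun j => hφ1 i j x) (fun j => (hφ i j).differentiable_gradient x) (b i)).fderiv,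
      sub_eq_iff_eq_add]
    ext1 v
    simp only [add_apply, hHdef, sum_apply,
      ContinuousLinearMap.smulRight_apply, smul_apply,
      sub_apply, innerSL_apply_apply, smul_eq_mul, hp',
      Finset.sum_add_distrib, mul_sub]
  have hL : 0 ≤ L := (norm_nonneg _).trans (hHessφ ⟨0, hN⟩ ⟨0, hc⟩ x)
  have hbound : ‖fderiv ℝ (gradient f) x - H x‖ ≤ 2 * L * f x := by
    rw [hdiff, hf, Finset.mul_sum]
    refine norm_sum_le_of_le _ fun i _ => ?_
    calc _ ≤ ∑ j, |Real.exp (φ i j x - logSumExp (φ i) x) - if j = b i then 1 else 0| * L :=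
          norm_sum_le_of_le _ fun j _ => by
            rw [norm_smul, Real.norm_eq_abs]
            gcongr
            exact hHessφ i j x
      _ ≤ 2 * (logSumExp (φ i) x - φ i (b i) x) * L := by
          rw [← Finset.sum_mul]
          gcongr
          exact sum_abs_softmax_sub_le (φ i) x (b i)
      _ = _ := by ring
  calc _ ≤ 2 * L * f x := hbound
    _ ≤ 2 * L * (1 / (2 * μ) * ‖gradient f x‖ ^ 2 + f xstar) := by
        gcongr
        linarith [hPL x]
    _ = _ := by field_simp
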